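/- arXiv:1002.4604 — 6 statements merged into one kernel-verified Lean document; each statement's English description precedes it below -/
import Mathlib

section
/- Let (A, B) be a co-t-structure on a triangulated category T and ω := A ∩ B. Then: (a) id_A(B) = 0 and A ⊆ A[-1]*ω; (b) pd_B(A) = 0 and B ⊆ ω*B[1]. In particular, ω is an A-injective weak-cogenerator in A and a B-projective weak-generator in B. -/
open CategoryTheory CategoryTheory.Limits CategoryTheory.Pretriangulated

universe v u

variable (C : Type u) [Category.{v} C] [HasZeroObject C] [HasShift C ℤ]
  [Preadditive C] [∀ n : ℤ, (CategoryTheory.shiftFunctor C n).Additive]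
  [Pretriangulated C]

namespace CotPaper

variable {C}

/-- The shift `X⟦n⟧` of a class of objects `X` by `n ∈ ℤ`, closed under isomorphism. -/
def shf (X : Set C) (n : ℤ) : Set C := {Z | ∃ A ∈ X, Nonempty (Z ≅ A⟦n⟧)}

/-- `star X Y` consists of the objects `Z` fitting in a distinguished triangle
`A ⟶ Z ⟶ B ⟶ A⟦1⟧` with `A ∈ X` and `B ∈ Y`. -/
def star (X Y : Set C) : Set C :=
  {Z | ∃ (A B : C) (f : A ⟶ Z) (g : Z ⟶ B) (h : B ⟶ A⟦(1:ℤ)⟧),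
    A ∈ X ∧ B ∈ Y ∧ Triangle.mk f g h ∈ distTriang C}

/-- `X^⊥ = {Z : Hom(X', Z) = 0 for all X' ∈ X}`. -/
def rightOrth (X : Set C) : Set C := {Z | ∀ A ∈ X, ∀ f : A ⟶ Z, f = 0}

/-- `⊥X = {Z : Hom(Z, X') = 0 for all X' ∈ X}`. -/
def leftOrth (X : Set C) : Set C := {Z | ∀ B ∈ X, ∀ f : Z ⟶ B, f = 0}

/-- A class of objects is closed under isomorphisms. -/
def isoClosed (X : Set C) : Prop := ∀ ⦃A B : C⦄, A ∈ X → (A ≅ B) → B ∈ X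

/-- A class of objects is closed under direct summands. -/
def summandClosed (X : Set C) : Prop :=
  ∀ ⦃W Z : C⦄, W ∈ X → (∃ (i : Z ⟶ W) (r : W ⟶ Z), i ≫ r = 𝟙 Z) → Z ∈ X

/-- `W` is a direct sum of `A` and `B` (i.e. carries a binary biproduct structure). -/
def isDirectSum (W A B : C) : Prop :=
  ∃ (iA : A ⟶ W) (iB : B ⟶ W) (pA : W ⟶ A) (pB : W ⟶ B),
    iA ≫ pA = 𝟙 A ∧ iB ≫ pB = 𝟙 B ∧ iA ≫ pB = 0 ∧ iB ≫ pA = 0 ∧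
      pA ≫ iA + pB ≫ iB = 𝟙 W

/-- An additive class of objects: it contains a zero object and is closed under
finite (binary) direct sums. -/
def addClosed (X : Set C) : Prop :=
  (∃ Z ∈ X, IsZero Z) ∧ ∀ ⦃A B W : C⦄, A ∈ X → B ∈ X → isDirectSum W A B → W ∈ X

/-- `X = add X` : `X` is closed under isomorphisms, finite direct sums and direct summands. -/
def isAdd (X : Set C) : Prop := isoClosed X ∧ addClosed X ∧ summandClosed X

/-- A class is suspended if it is closed under `[1]` and under extensions. -/
def suspended (X : Set C) : Prop := shf X 1 ⊆ X ∧ star X X ⊆ X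

/-- A class is cosuspended if it is closed under `[-1]` and under extensions. -/
def cosuspended (X : Set C) : Prop := shf X (-1) ⊆ X ∧ star X X ⊆ X

/-- `ε^∧_n(X)`: defined inductively, `ε^∧_0(X) = X` and `Z ∈ ε^∧_{n+1}(X)` iff there is a
distinguished triangle `Z⟦-1⟧ ⟶ W ⟶ A ⟶ Z` (equivalently `W ⟶ A ⟶ Z ⟶ W⟦1⟧`) with
`W ∈ ε^∧_n(X)` and `A ∈ X`. -/
def epsHat (X : Set C) : ℕ → Set C
  | 0 => X
  | n + 1 =>
    {Z | ∃ (W A : C) (f : W ⟶ A) (g : A ⟶ Z) (h : Z ⟶ W⟦(1:ℤ)⟧),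
      W ∈ epsHat X n ∧ A ∈ X ∧ Triangle.mk f g h ∈ distTriang C}

/-- `ε^∨_n(X)`: `ε^∨_0(X) = X` and `Z ∈ ε^∨_{n+1}(X)` iff there is a distinguished
triangle `Z ⟶ A ⟶ K ⟶ Z⟦1⟧` with `A ∈ X` and `K ∈ ε^∨_n(X)`. -/
def epsCheck (X : Set C) : ℕ → Set C
  | 0 => X
  | n + 1 =>
    {Z | ∃ (A K : C) (f : Z ⟶ A) (g : A ⟶ K) (h : K ⟶ Z⟦(1:ℤ)⟧),
      A ∈ X ∧ K ∈ epsCheck X n ∧ Triangle.mk f g h ∈ distTriang C}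

/-- `X^∧ := ∪_{n ≥ 0} ε^∧_n(X)`. -/
def hat (X : Set C) : Set C := ⋃ n : ℕ, epsHat X n

/-- `X^∨ := ∪_{n ≥ 0} ε^∨_n(X)`. -/
def check (X : Set C) : Set C := ⋃ n : ℕ, epsCheck X n

/-- `X~ := (X^∧)^∨`. -/
def tilde (X : Set C) : Set C := check (hat X)

/-- `resdim_X(M) := min {n : M ∈ ε^∧_n(X)}`, with `min ∅ = ∞`. -/
noncomputable def resdim (X : Set C) (M : C) : ℕ∞ :=
  sInf {n : ℕ∞ | ∃ m : ℕ, n = (m : ℕ∞) ∧ M ∈ epsHat X m}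

/-- `coresdim_X(M) := min {n : M ∈ ε^∨_n(X)}`, with `min ∅ = ∞`. -/
noncomputable def coresdim (X : Set C) (M : C) : ℕ∞ :=
  sInf {n : ℕ∞ | ∃ m : ℕ, n = (m : ℕ∞) ∧ M ∈ epsCheck X m}

/-- `id_X(M) := min {n ∈ ℕ : Hom(-, M[i])|_X = 0 for all i > n}`, with `min ∅ = ∞`. -/
noncomputable def idDim (X : Set C) (M : C) : ℕ∞ :=
  sInf {n : ℕ∞ | ∃ m : ℕ, n = (m : ℕ∞) ∧
    ∀ i : ℤ, (m : ℤ) < i → ∀ A ∈ X, ∀ f : A ⟶ M⟦i⟧, f = 0}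

/-- `pd_X(M) := min {n ∈ ℕ : Hom(M[-i], -)|_X = 0 for all i > n}`, with `min ∅ = ∞`. -/
noncomputable def pdDim (X : Set C) (M : C) : ℕ∞ :=
  sInf {n : ℕ∞ | ∃ m : ℕ, n = (m : ℕ∞) ∧
    ∀ i : ℤ, (m : ℤ) < i → ∀ B ∈ X, ∀ f : M⟦(-i : ℤ)⟧ ⟶ B, f = 0}

/-- `id_X(Y) := sup {id_X(M) : M ∈ Y}`. -/
noncomputable def idDimSet (X Y : Set C) : ℕ∞ := ⨆ M ∈ Y, idDim X M

/-- `pd_X(Y) := sup {pd_X(M) : M ∈ Y}`. -/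
noncomputable def pdDimSet (X Y : Set C) : ℕ∞ := ⨆ M ∈ Y, pdDim X M

/-- `ω` is `X`-injective: `id_X(W) = 0` for every `W ∈ ω`. -/
def xInjective (X ω : Set C) : Prop := ∀ W ∈ ω, idDim X W = 0

/-- `ω` is `X`-projective: `pd_X(W) = 0` for every `W ∈ ω`. -/
def xProjective (X ω : Set C) : Prop := ∀ W ∈ ω, pdDim X W = 0

/-- `ω` is a weak-cogenerator in `X`: `ω ⊆ X ⊆ X[-1] * ω`. -/
def weakCogenerator (ω X : Set C) : Prop := ω ⊆ X ∧ X ⊆ star (shf X (-1)) ω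

/-- `ω` is a weak-generator in `X`: `ω ⊆ X ⊆ ω * X[1]`. -/
def weakGenerator (ω X : Set C) : Prop := ω ⊆ X ∧ X ⊆ star ω (shf X 1)

/-- `ω` is silting: `Hom(W, W'[i]) = 0` for all `W, W' ∈ ω` and all `i > 0`. -/
def silting (ω : Set C) : Prop :=
  ∀ W ∈ ω, ∀ W' ∈ ω, ∀ i : ℤ, 0 < i → ∀ f : W ⟶ W'⟦i⟧, f = 0

/-- A thick subcategory: a (full, additive, isomorphism-closed) triangulated subcategory
closed under direct summands. -/
structure IsThick (S : Set C) : Prop where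
  zero : ∃ Z ∈ S, IsZero Z
  iso : isoClosed S
  shift : ∀ n : ℤ, shf S n ⊆ S
  ext : star S S ⊆ S
  summand : summandClosed S

/-- `Δ̄_T(X)`: the smallest thick subcategory containing `X`. -/
def thickClosure (X : Set C) : Set C := ⋂₀ {S : Set C | IsThick S ∧ X ⊆ S}

/-- `U_ω`: the smallest suspended class containing `ω`. -/
def uPlus (ω : Set C) : Set C := ⋂₀ {S : Set C | suspended S ∧ ω ⊆ S}

/-- `_ωU`: the smallest cosuspended class containing `ω`. -/
def uMinus (ω : Set C) : Set C := ⋂₀ {S : Set C | cosuspended S ∧ ω ⊆ S}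

/-- `_ωŪ`: the smallest cosuspended class containing `ω` closed under direct summands. -/
def uMinusBar (ω : Set C) : Set C :=
  ⋂₀ {S : Set C | cosuspended S ∧ summandClosed S ∧ ω ⊆ S}

/-- `(A, B)` is a co-t-structure on the triangulated subcategory `S` of `C`:
`A` and `B` are full additive subcategories of `S` closed under isomorphisms and direct
summands, `A[-1] ⊆ A`, `B[1] ⊆ B`, `Hom(A[-1], B) = 0` and `S = A[-1] * B`. -/
structure IsCotStructure (S A B : Set C) : Prop where
  subA : A ⊆ S
  subB : B ⊆ S
  isoA : isoClosed A
  isoB : isoClosed B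
  addA : addClosed A
  addB : addClosed B
  summandA : summandClosed A
  summandB : summandClosed B
  shiftA : shf A (-1) ⊆ A
  shiftB : shf B 1 ⊆ B
  orth : ∀ A' ∈ shf A (-1), ∀ B' ∈ B, ∀ f : A' ⟶ B', f = 0
  decomp : S = star (shf A (-1)) B

/-- A relative Auslander-Buchweitz context on `C` : `X` is cosuspended and closed under
direct summands, `Y` is suspended, closed under direct summands and `Y ⊆ X^∧`, and
`ω := X ∩ Y` is an `X`-injective weak-cogenerator in `X`. -/
structure RelativeABContext (X Y : Set C) : Prop where
  cosusp : cosuspended X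
  summandX : summandClosed X
  susp : suspended Y
  summandY : summandClosed Y
  sub : Y ⊆ hat X
  inj : xInjective X (X ∩ Y)
  wcog : weakCogenerator (X ∩ Y) X


section Helpers

theorem aux_orth {A B : Set C} (h : IsCotStructure Set.univ A B) {X Z : C} (hX : X ∈ A)
    (hZ : Z ∈ shf B 1) (f : X ⟶ Z) : f = 0 := by
  obtain ⟨Y, hY, ⟨e⟩⟩ := hZ
  have key : (shiftFunctor C (-1 : ℤ)).map (f ≫ e.hom) ≫
      (shiftShiftNeg Y (1 : ℤ)).hom = 0 := h.orth _ ⟨X, hX, ⟨Iso.refl _⟩⟩ _ hY _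
  have k2 : (shiftFunctor C (-1 : ℤ)).map (f ≫ e.hom) = 0 := by
    rw [← cancel_mono (shiftShiftNeg Y (1 : ℤ)).hom, key, zero_comp]
  have k3 : f ≫ e.hom = 0 := by
    apply (shiftFunctor C (-1 : ℤ)).map_injective
    rw [k2, Functor.map_zero]
  rw [← cancel_mono e.hom, k3, zero_comp]

theorem aux_up {A : Set C} (hi : isoClosed A) {P : C} (hP : P ∈ shf A (-1)) :
    P⟦(1 : ℤ)⟧ ∈ A := by
  obtain ⟨Y, hY, ⟨e⟩⟩ := hP
  exact hi hY ((shiftFunctor C (1 : ℤ)).mapIso e ≪≫ shiftNegShift Y (1 : ℤ)).symm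

theorem aux_replace (T : Triangle C) (hT : T ∈ distTriang C) {X : C} (e : T.obj₂ ≅ X) :
    Triangle.mk (T.mor₁ ≫ e.hom) (e.inv ≫ T.mor₂) T.mor₃ ∈ distTriang C := by
  refine isomorphic_distinguished _ hT _ ?_
  have h1 : (T.mor₁ ≫ e.hom) ≫ e.inv = 𝟙 T.obj₁ ≫ T.mor₁ := by simp
  have h2 : (e.inv ≫ T.mor₂) ≫ 𝟙 T.obj₃ = e.inv ≫ T.mor₂ := by simp
  have h3 : T.mor₃ ≫ (shiftFunctor C (1 : ℤ)).map (𝟙 T.obj₁) = 𝟙 T.obj₃ ≫ T.mor₃ := by simp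
  exact Triangle.isoMk _ _ (Iso.refl _) e.symm (Iso.refl _) h1 h2 h3

theorem aux_decomp {A B : Set C} (h : IsCotStructure Set.univ A B) (X : C) :
    X ∈ star A (shf B 1) := by
  have hX : X⟦(-1 : ℤ)⟧ ∈ star (shf A (-1)) B := by rw [← h.decomp]; trivial
  obtain ⟨P, Q, f, g, k, hP, hQ, hT⟩ := hX
  have hT' := Triangle.shift_distinguished _ hT 1
  let e : (X⟦(-1 : ℤ)⟧)⟦(1 : ℤ)⟧ ≅ X := shiftNegShift X (1 : ℤ)
  let T := (Triangle.shiftFunctor C 1).obj (Triangle.mk f g k)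
  refine ⟨P⟦(1 : ℤ)⟧, Q⟦(1 : ℤ)⟧, T.mor₁ ≫ e.hom, e.inv ≫ T.mor₂, T.mor₃, aux_up h.isoA hP,
    ⟨Q, hQ, ⟨Iso.refl _⟩⟩, ?_⟩
  exact aux_replace T hT' e

theorem aux_memA {A B : Set C} (h : IsCotStructure Set.univ A B) {X : C}
    (hX : ∀ Z ∈ shf B 1, ∀ f : X ⟶ Z, f = 0) : X ∈ A := by
  obtain ⟨P, Q, f, g, k, hP, hQ, hT⟩ := aux_decomp h X
  obtain ⟨φ, hφ⟩ := Triangle.coyoneda_exact₂ _ hT (𝟙 X) (by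
    change 𝟙 X ≫ g = 0
    rw [hX _ hQ g, comp_zero])
  exact h.summandA hP ⟨φ, f, hφ.symm⟩

theorem aux_memB {A B : Set C} (h : IsCotStructure Set.univ A B) {X : C}
    (hX : ∀ Z ∈ shf A (-1), ∀ f : Z ⟶ X, f = 0) : X ∈ B := by
  have hd : X ∈ star (shf A (-1)) B := by rw [← h.decomp]; trivial
  obtain ⟨P, Q, f, g, k, hP, hQ, hT⟩ := hd
  obtain ⟨φ, hφ⟩ := Triangle.yoneda_exact₂ _ hT (𝟙 X) (by
    change f ≫ 𝟙 X = 0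
    rw [hX _ hP f, zero_comp])
  exact h.summandB hQ ⟨g, φ, hφ.symm⟩

theorem aux_shift {X : Set C} (ε : ℤ) (hi : isoClosed X) (hs : shf X ε ⊆ X) {M : C}
    (hM : M ∈ X) (n : ℕ) : M⟦((n : ℤ) * ε)⟧ ∈ X := by
  induction n with
  | zero =>
    exact hi hM ((shiftFunctorZero' C (((0 : ℕ) : ℤ) * ε) (by simp)).app M).symm
  | succ n ih =>
    exact hs ⟨_, ih, ⟨(shiftFunctorAdd' C ((n : ℤ) * ε) ε (((n + 1 : ℕ) : ℤ) * ε)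
      (by push_cast; ring)).app M⟩⟩

theorem aux_shift_pos {X : Set C} (ε : ℤ) (hi : isoClosed X) (hs : shf X ε ⊆ X) {M : C}
    (hM : M ∈ X) (i : ℤ) (h0 : 0 < i) : M⟦i * ε⟧ ∈ shf X ε := by
  obtain ⟨n, hn⟩ := Int.eq_ofNat_of_zero_le (show 0 ≤ i - 1 by omega)
  have hi' : i = n + 1 := by omega
  exact ⟨_, aux_shift ε hi hs hM n, ⟨(shiftFunctorAdd' C ((n : ℤ) * ε) ε (i * ε)
      (by rw [hi']; ring)).app M⟩⟩

theorem aux_id {A B : Set C} (h : IsCotStructure Set.univ A B) {M : C} (hM : M ∈ B) :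
    idDim A M = 0 := by
  refine le_antisymm (sInf_le ⟨0, by simp, ?_⟩) bot_le
  intro i hi X hX f
  have := aux_shift_pos 1 h.isoB h.shiftB hM i (by simpa using hi)
  rw [mul_one] at this
  exact aux_orth h hX this f

theorem aux_pd {A B : Set C} (h : IsCotStructure Set.univ A B) {M : C} (hM : M ∈ A) :
    pdDim B M = 0 := by
  refine le_antisymm (sInf_le ⟨0, by simp, ?_⟩) bot_le
  intro i hi X hX f
  have := aux_shift_pos (-1) h.isoA h.shiftA hM i (by simpa using hi)
  rw [mul_neg_one] at this
  exact h.orth _ this _ hX f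

theorem aux_a {A B : Set C} (h : IsCotStructure Set.univ A B) :
    A ⊆ star (shf A (-1)) (A ∩ B) := by
  intro M hM
  have hd : M ∈ star (shf A (-1)) B := by rw [← h.decomp]; trivial
  obtain ⟨P, Q, f, g, k, hP, hQ, hT⟩ := hd
  refine ⟨P, Q, f, g, k, hP, ⟨aux_memA h ?_, hQ⟩, hT⟩
  intro Z hZ u
  obtain ⟨φ, hφ⟩ := Triangle.yoneda_exact₃ _ hT u (aux_orth h hM hZ _)
  rw [hφ, aux_orth h (aux_up h.isoA hP) hZ φ]
  exact comp_zero

theorem aux_b {A B : Set C} (h : IsCotStructure Set.univ A B) :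
    B ⊆ star (A ∩ B) (shf B 1) := by
  intro N hN
  obtain ⟨P, Q, f, g, k, hP, hQ, hT⟩ := aux_decomp h N
  refine ⟨P, Q, f, g, k, ⟨hP, aux_memB h ?_⟩, hQ, hT⟩
  intro Z hZ u
  obtain ⟨φ, hφ⟩ := Triangle.coyoneda_exact₂ _ (inv_rot_of_distTriang _ hT) u
    (h.orth _ hZ _ hN _)
  have hQ' : Q⟦(-1 : ℤ)⟧ ∈ B := by
    obtain ⟨Y, hY, ⟨e⟩⟩ := hQ
    exact h.isoB hY ((shiftFunctor C (-1 : ℤ)).mapIso e ≪≫ shiftShiftNeg Y (1 : ℤ)).symm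
  rw [hφ, h.orth _ hZ _ hQ' φ]
  exact zero_comp

end Helpers

/-- Let `(A, B)` be a co-t-structure on `T` and `ω := A ∩ B`. Then:
(a) `id_A(B) = 0` and `A ⊆ A[-1] * ω`; (b) `pd_B(A) = 0` and `B ⊆ ω * B[1]`.
In particular, `ω` is an `A`-injective weak-cogenerator in `A` and a `B`-projective
weak-generator in `B`. -/
theorem stmt14 (A B : Set C) (h : IsCotStructure Set.univ A B) :
    (idDimSet A B = 0 ∧ A ⊆ star (shf A (-1)) (A ∩ B)) ∧
    (pdDimSet B A = 0 ∧ B ⊆ star (A ∩ B) (shf B 1)) ∧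
    (xInjective A (A ∩ B) ∧ weakCogenerator (A ∩ B) A) ∧
    (xProjective B (A ∩ B) ∧ weakGenerator (A ∩ B) B) := by
  refine ⟨⟨?_, aux_a h⟩, ⟨?_, aux_b h⟩, ⟨fun W hW => aux_id h hW.2, Set.inter_subset_left, aux_a h⟩,
    ⟨fun W hW => aux_pd h hW.1, Set.inter_subset_right, aux_b h⟩⟩
  · exact le_antisymm (iSup₂_le fun M hM => (aux_id h hM).le) bot_le
  · exact le_antisymm (iSup₂_le fun M hM => (aux_pd h hM).le) bot_le

end CotPaper
end

section
/- Let (A, B) be a co-t-structure on a triangulated category T and ω := A ∩ B. Then: (a) pd_B(M) = resdim_A(M) and id_A(M) = coresdim_B(M) for all M ∈ T; (b) resdim_A(M) = resdim_ω(M) for all M ∈ ω^∧; (c) coresdim_B(M) = coresdim_ω(M) for all M ∈ ω^∨. -/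
open CategoryTheory CategoryTheory.Limits CategoryTheory.Pretriangulated

universe v u

variable (C : Type u) [Category.{v} C] [HasZeroObject C] [HasShift C ℤ]
  [Preadditive C] [∀ n : ℤ, (CategoryTheory.shiftFunctor C n).Additive]
  [Pretriangulated C]

namespace CotPaper

variable {C}

def HZ (X Y : C) : Prop := ∀ f : X ⟶ Y, f = 0

lemma HZ.of_iso {X Y X' Y' : C} (h : HZ X Y) (e : X ≅ X') (e' : Y ≅ Y') : HZ X' Y' := by
  intro f
  have h1 := h (e.hom ≫ f ≫ e'.inv)
  have h2 : f = e.inv ≫ (e.hom ≫ f ≫ e'.inv) ≫ e'.hom := by simp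
  rw [h2, h1]; simp

lemma HZ.shift_iff {X Y : C} (k : ℤ) : HZ (X⟦k⟧) (Y⟦k⟧) ↔ HZ X Y := by
  constructor
  · intro h f
    apply (shiftFunctor C k).map_injective
    rw [h ((shiftFunctor C k).map f), Functor.map_zero]
  · intro h f
    obtain ⟨g, rfl⟩ := (shiftFunctor C k).map_surjective f
    rw [h g, Functor.map_zero]

lemma HZ.right_add {X Y : C} (m n k : ℤ) (e : m + n = k) :
    HZ X ((Y⟦m⟧)⟦n⟧) ↔ HZ X (Y⟦k⟧) := by
  have i := (shiftFunctorAdd' C m n k e).app Y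
  exact ⟨fun h => h.of_iso (Iso.refl _) i.symm, fun h => h.of_iso (Iso.refl _) i⟩

lemma HZ.zero_iff {X Y : C} : HZ X (Y⟦(0:ℤ)⟧) ↔ HZ X Y := by
  have i := (shiftFunctorZero C ℤ).app Y
  exact ⟨fun h => h.of_iso (Iso.refl _) i, fun h => h.of_iso (Iso.refl _) i.symm⟩

/-- moving a shift on the left -/
lemma HZ.left {X Y : C} (m n k : ℤ) (e : k + m = n) :
    HZ (X⟦m⟧) (Y⟦n⟧) ↔ HZ X (Y⟦k⟧) := by
  rw [← HZ.right_add k m n e, HZ.shift_iff]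

lemma HZ.left0 {X Y : C} (m k : ℤ) (e : k + m = 0) :
    HZ (X⟦m⟧) Y ↔ HZ X (Y⟦k⟧) := by
  rw [← HZ.zero_iff, HZ.left m 0 k e]

def RR (B : Set C) (n : ℤ) (M : C) : Prop := ∀ b ∈ B, HZ M (b⟦n⟧)

def LL (A : Set C) (n : ℤ) (M : C) : Prop := ∀ a ∈ A, HZ a (M⟦n⟧)

lemma RR.ext {B : Set C} {n : ℤ} {T : Triangle C} (hT : T ∈ distTriang C)
    (h1 : RR B n T.obj₁) (h3 : RR B n T.obj₃) : RR B n T.obj₂ := by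
  intro b hb f
  obtain ⟨g, hg⟩ := Triangle.yoneda_exact₂ T hT f (h1 b hb _)
  rw [hg, h3 b hb g, comp_zero]

lemma LL.ext {A : Set C} {n : ℤ} {T : Triangle C} (hT : T ∈ distTriang C)
    (h1 : LL A n T.obj₁) (h3 : LL A n T.obj₃) : LL A n T.obj₂ := by
  intro a ha
  rw [← HZ.left0 (-n) n (by omega)]
  have h1' := (HZ.left0 (-n) n (by omega)).2 (h1 a ha)
  have h3' := (HZ.left0 (-n) n (by omega)).2 (h3 a ha)
  intro f
  obtain ⟨g, hg⟩ := Triangle.coyoneda_exact₂ T hT f (h3' _)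
  rw [hg, h1' g, zero_comp]

lemma RR.shift {B : Set C} (m n k : ℤ) (e : k + m = n) {M : C} :
    RR B n (M⟦m⟧) ↔ RR B k M :=
  forall₂_congr fun _ _ => HZ.left m n k e

lemma LL.shift {A : Set C} (m n k : ℤ) (e : m + n = k) {M : C} :
    LL A n (M⟦m⟧) ↔ LL A k M :=
  forall₂_congr fun _ _ => HZ.right_add m n k e

lemma distinguished_third {X Y Z Z' : C} {f : X ⟶ Y} {g : Y ⟶ Z} {h : Z ⟶ X⟦(1:ℤ)⟧}
    (hT : Triangle.mk f g h ∈ distTriang C) (e : Z ≅ Z') :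
    Triangle.mk f (g ≫ e.hom) (e.inv ≫ h) ∈ distTriang C :=
  isomorphic_distinguished _ hT _
    (Triangle.isoMk _ _ (Iso.refl _) (Iso.refl _) e.symm 
      ((Category.comp_id f).trans (Category.id_comp f).symm)
      (show (g ≫ e.hom) ≫ e.inv = 𝟙 Y ≫ g by simp)
      (show (e.inv ≫ h) ≫ (shiftFunctor C (1:ℤ)).map (𝟙 X) = e.inv ≫ h by simp))

section
variable {A B : Set C}

theorem memA_iff (h : IsCotStructure Set.univ A B) (M : C) : M ∈ A ↔ RR B 1 M := by
  constructor
  · intro hM b hb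
    rw [← HZ.left0 (-1) 1 (by omega)]
    exact h.orth _ ⟨M, hM, ⟨Iso.refl _⟩⟩ b hb
  · intro hM
    have hd : M⟦(-1:ℤ)⟧ ∈ star (shf A (-1)) B := by rw [← h.decomp]; trivial
    obtain ⟨X, b, f, g, k, ⟨a, ha, ⟨e⟩⟩, hb, hT⟩ := hd
    have hg : g = 0 := (HZ.left0 (-1) 1 (by omega)).2 (hM b hb) g
    obtain ⟨s, hs⟩ : ∃ s : M⟦(-1:ℤ)⟧ ⟶ X, 𝟙 (M⟦(-1:ℤ)⟧) = s ≫ f :=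
      Triangle.coyoneda_exact₂ _ hT (𝟙 (M⟦(-1:ℤ)⟧)) ((Category.id_comp g).trans hg)
    obtain ⟨i, hi⟩ := (shiftFunctor C (-1:ℤ)).map_surjective (s ≫ e.hom)
    obtain ⟨r, hr⟩ := (shiftFunctor C (-1:ℤ)).map_surjective (e.inv ≫ f)
    refine h.summandA ha ⟨i, r, ?_⟩
    apply (shiftFunctor C (-1:ℤ)).map_injective
    rw [Functor.map_comp, hi, hr, CategoryTheory.Functor.map_id]
    simpa using hs.symm

theorem shfA (h : IsCotStructure Set.univ A B) {X : C} (hX : X ∈ shf A (-1)) :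
    X⟦(1:ℤ)⟧ ∈ A := by
  rw [memA_iff h, RR.shift 1 1 0 (by omega)]
  intro b hb
  rw [HZ.zero_iff]
  exact h.orth _ hX b hb

theorem memB_iff (h : IsCotStructure Set.univ A B) (M : C) : M ∈ B ↔ LL A 1 M := by
  constructor
  · intro hM a ha
    rw [← HZ.left0 (-1) 1 (by omega)]
    exact h.orth _ ⟨a, ha, ⟨Iso.refl _⟩⟩ M hM
  · intro hM
    have hd : M ∈ star (shf A (-1)) B := by rw [← h.decomp]; trivial
    obtain ⟨X, b, f, g, k, hX, hb, hT⟩ := hd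
    have hf : f = 0 := (HZ.shift_iff (1:ℤ)).1 (hM _ (shfA h hX)) f
    obtain ⟨s, hs⟩ : ∃ s : b ⟶ M, 𝟙 M = g ≫ s :=
      Triangle.yoneda_exact₂ _ hT (𝟙 M) ((Category.comp_id f).trans hf)
    exact h.summandB hb ⟨g, s, hs.symm⟩

theorem RR.mono (h : IsCotStructure Set.univ A B) {M : C} {n : ℤ} (hM : RR B n M)
    {m : ℤ} (hm : n ≤ m) : RR B m M := by
  induction m, hm using Int.leInduction with
  | base => exact hM
  | succ m _ ih =>
    intro b hb
    rw [← HZ.right_add 1 m (m+1) (by omega)]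
    exact ih _ (h.shiftB ⟨b, hb, ⟨Iso.refl _⟩⟩)

theorem LL.mono (h : IsCotStructure Set.univ A B) {M : C} {n : ℤ} (hM : LL A n M)
    {m : ℤ} (hm : n ≤ m) : LL A m M := by
  induction m, hm using Int.leInduction with
  | base => exact hM
  | succ m _ ih =>
    intro a ha
    rw [← HZ.left (-1) m (m+1) (by omega)]
    exact ih _ (h.shiftA ⟨a, ha, ⟨Iso.refl _⟩⟩)

theorem exA (h : IsCotStructure Set.univ A B) (Z : C) :
    ∃ (W X : C) (f : W ⟶ X) (g : X ⟶ Z) (k : Z ⟶ W⟦(1:ℤ)⟧),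
      W ∈ B ∧ X ∈ A ∧ Triangle.mk f g k ∈ distTriang C := by
  have hd : Z⟦(-1:ℤ)⟧ ∈ star (shf A (-1)) B := by rw [← h.decomp]; trivial
  obtain ⟨X, b, f, g, k, hX, hb, hT⟩ := hd
  have hT' := rot_of_distTriang _ (rot_of_distTriang _ hT)
  exact ⟨b, X⟦(1:ℤ)⟧, _, _, _, hb, shfA h hX,
    distinguished_third hT' ((shiftFunctorCompIsoId C (-1:ℤ) 1 (by omega)).app Z)⟩

theorem exB (h : IsCotStructure Set.univ A B) (Z : C) :
    ∃ (X K : C) (f : Z ⟶ X) (g : X ⟶ K) (k : K ⟶ Z⟦(1:ℤ)⟧),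
      X ∈ B ∧ K ∈ A ∧ Triangle.mk f g k ∈ distTriang C := by
  have hd : Z ∈ star (shf A (-1)) B := by rw [← h.decomp]; trivial
  obtain ⟨X, b, f, g, k, hX, hb, hT⟩ := hd
  exact ⟨b, X⟦(1:ℤ)⟧, _, _, _, hb, shfA h hX, rot_of_distTriang _ hT⟩

theorem RR_W (h : IsCotStructure Set.univ A B) {W X Z : C} {f : W ⟶ X} {g : X ⟶ Z}
    {k : Z ⟶ W⟦(1:ℤ)⟧} (hT : Triangle.mk f g k ∈ distTriang C) (hX : X ∈ A) (n : ℕ)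
    (hZ : RR B (n + 2) Z) : RR B (n + 1) W := by
  have hX1 : RR B (n + 1) X := RR.mono h ((memA_iff h X).1 hX) (by omega)
  have := RR.ext (n := (n + 2 : ℤ)) (rot_of_distTriang _ (rot_of_distTriang _ hT)) hZ
    ((RR.shift 1 (n + 2) (n + 1) (by omega)).2 hX1)
  exact (RR.shift 1 (n + 2) (n + 1) (by omega)).1 this

theorem LL_K (h : IsCotStructure Set.univ A B) {Z X K : C} {f : Z ⟶ X} {g : X ⟶ K}
    {k : K ⟶ Z⟦(1:ℤ)⟧} (hT : Triangle.mk f g k ∈ distTriang C) (hX : X ∈ B) (n : ℕ)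
    (hZ : LL A (n + 2) Z) : LL A (n + 1) K :=
  LL.ext (n := (n + 1 : ℤ)) (rot_of_distTriang _ hT)
    (LL.mono h ((memB_iff h X).1 hX) (by omega))
    ((LL.shift 1 (n + 1) (n + 2) (by omega)).2 hZ)

theorem epsHat_iff (h : IsCotStructure Set.univ A B) (n : ℕ) (M : C) :
    M ∈ epsHat A n ↔ RR B (n + 1) M := by
  induction n generalizing M with
  | zero => simpa [epsHat] using memA_iff h M
  | succ n ih =>
    have e : ((n + 1 : ℕ) : ℤ) + 1 = n + 2 := by push_cast; ring
    rw [e]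
    constructor
    · rintro ⟨W, X, f, g, k, hW, hX, hT⟩
      exact RR.ext (n := (n + 2 : ℤ)) (rot_of_distTriang _ hT)
        (RR.mono h ((memA_iff h X).1 hX) (by omega))
        ((RR.shift 1 (n + 2) (n + 1) (by omega)).2 ((ih W).1 hW))
    · intro hM
      obtain ⟨W, X, f, g, k, hW, hX, hT⟩ := exA h M
      exact ⟨W, X, f, g, k, (ih W).2 (RR_W h hT hX n hM), hX, hT⟩

theorem epsCheck_iff (h : IsCotStructure Set.univ A B) (n : ℕ) (M : C) :
    M ∈ epsCheck B n ↔ LL A (n + 1) M := by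
  induction n generalizing M with
  | zero => simpa [epsCheck] using memB_iff h M
  | succ n ih =>
    have e : ((n + 1 : ℕ) : ℤ) + 1 = n + 2 := by push_cast; ring
    rw [e]
    constructor
    · rintro ⟨X, K, f, g, k, hX, hK, hT⟩
      exact LL.ext (n := (n + 2 : ℤ)) (inv_rot_of_distTriang _ hT)
        ((LL.shift (-1) (n + 2) (n + 1) (by omega)).2 ((ih K).1 hK))
        (LL.mono h ((memB_iff h X).1 hX) (by omega))
    · intro hM
      obtain ⟨X, K, f, g, k, hX, hK, hT⟩ := exB h M
      exact ⟨X, K, f, g, k, hX, (ih K).2 (LL_K h hT hX n hM), hT⟩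

theorem epsHat_omega (h : IsCotStructure Set.univ A B) (n : ℕ) (M : C) (hB : M ∈ B)
    (hM : RR B (n + 1) M) : M ∈ epsHat (A ∩ B) n := by
  induction n generalizing M with
  | zero => exact ⟨(memA_iff h M).2 (by simpa using hM), hB⟩
  | succ n ih =>
    have e : ((n + 1 : ℕ) : ℤ) + 1 = n + 2 := by push_cast; ring
    rw [e] at hM
    obtain ⟨W, X, f, g, k, hW, hX, hT⟩ := exA h M
    refine ⟨W, X, f, g, k, ih W hW (RR_W h hT hX n hM), ⟨hX, ?_⟩, hT⟩
    rw [memB_iff h] at hW hB ⊢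
    exact LL.ext hT hW hB

theorem epsCheck_omega (h : IsCotStructure Set.univ A B) (n : ℕ) (M : C) (hA : M ∈ A)
    (hM : LL A (n + 1) M) : M ∈ epsCheck (A ∩ B) n := by
  induction n generalizing M with
  | zero => exact ⟨hA, (memB_iff h M).2 (by simpa using hM)⟩
  | succ n ih =>
    have e : ((n + 1 : ℕ) : ℤ) + 1 = n + 2 := by push_cast; ring
    rw [e] at hM
    obtain ⟨X, K, f, g, k, hX, hK, hT⟩ := exB h M
    refine ⟨X, K, f, g, k, ⟨?_, hX⟩, ih K hK (LL_K h hT hX n hM), hT⟩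
    rw [memA_iff h] at hK hA ⊢
    exact RR.ext hT hA hK

theorem epsHat_mono {X Y : Set C} (hXY : X ⊆ Y) (n : ℕ) : epsHat X n ⊆ epsHat Y n := by
  induction n with
  | zero => exact hXY
  | succ n ih =>
    rintro Z ⟨W, X, f, g, k, hW, hX, hT⟩
    exact ⟨W, X, f, g, k, ih hW, hXY hX, hT⟩

theorem epsCheck_mono {X Y : Set C} (hXY : X ⊆ Y) (n : ℕ) :
    epsCheck X n ⊆ epsCheck Y n := by
  induction n with
  | zero => exact hXY
  | succ n ih =>
    rintro Z ⟨X, K, f, g, k, hX, hK, hT⟩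
    exact ⟨X, K, f, g, k, hXY hX, ih hK, hT⟩

theorem epsHat_sub (h : IsCotStructure Set.univ A B) (n : ℕ) : epsHat (A ∩ B) n ⊆ B := by
  induction n with
  | zero => exact fun _ hx => hx.2
  | succ n ih =>
    rintro Z ⟨W, X, f, g, k, hW, hX, hT⟩
    have h1 := (memB_iff h _).1 hX.2
    have h2 := (memB_iff h _).1 (h.shiftB ⟨W, ih hW, ⟨Iso.refl _⟩⟩)
    exact (memB_iff h _).2 (LL.ext (rot_of_distTriang _ hT) h1 h2)

theorem epsCheck_sub (h : IsCotStructure Set.univ A B) (n : ℕ) :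
    epsCheck (A ∩ B) n ⊆ A := by
  induction n with
  | zero => exact fun _ hx => hx.1
  | succ n ih =>
    rintro Z ⟨X, K, f, g, k, hX, hK, hT⟩
    have h1 := (memA_iff h _).1 hX.1
    have h2 := (memA_iff h _).1 (h.shiftA ⟨K, ih hK, ⟨Iso.refl _⟩⟩)
    exact (memA_iff h _).2 (RR.ext (inv_rot_of_distTriang _ hT) h2 h1)

end

/-- Let `(A, B)` be a co-t-structure on `T` and `ω := A ∩ B`. Then:
(a) `pd_B(M) = resdim_A(M)` and `id_A(M) = coresdim_B(M)` for all `M ∈ T`;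
(b) `resdim_A(M) = resdim_ω(M)` for all `M ∈ ω^∧`;
(c) `coresdim_B(M) = coresdim_ω(M)` for all `M ∈ ω^∨`. -/
theorem stmt15 (A B : Set C) (h : IsCotStructure Set.univ A B) :
    (∀ M : C, pdDim B M = resdim A M ∧ idDim A M = coresdim B M) ∧
    (∀ M ∈ hat (A ∩ B), resdim A M = resdim (A ∩ B) M) ∧
    (∀ M ∈ check (A ∩ B), coresdim B M = coresdim (A ∩ B) M) := by
  refine ⟨fun M => ⟨?_, ?_⟩, fun M hM => ?_, fun M hM => ?_⟩
  · unfold pdDim resdim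
    congr 1; ext n
    refine exists_congr fun m => and_congr_right fun _ => ?_
    rw [epsHat_iff h]
    constructor
    · intro H b hb
      exact (HZ.left0 (-(m + 1 : ℤ)) (m + 1) (by omega)).1 (H (m + 1) (by omega) b hb)
    · intro H i hi b hb
      exact (HZ.left0 (-i) i (by omega)).2 (RR.mono h H (by omega) b hb)
  · unfold idDim coresdim
    congr 1; ext n
    refine exists_congr fun m => and_congr_right fun _ => ?_
    rw [epsCheck_iff h]
    constructor
    · intro H
      exact H (m + 1) (by omega)
    · intro H i hi
      exact LL.mono h H (by omega)
  · obtain ⟨k, hk⟩ := Set.mem_iUnion.1 hM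
    unfold resdim
    congr 1; ext n
    refine exists_congr fun m => and_congr_right fun _ => ⟨fun H => ?_, fun H => ?_⟩
    · exact epsHat_omega h m M (epsHat_sub h k hk) ((epsHat_iff h m M).1 H)
    · exact epsHat_mono Set.inter_subset_left m H
  · obtain ⟨k, hk⟩ := Set.mem_iUnion.1 hM
    unfold coresdim
    congr 1; ext n
    refine exists_congr fun m => and_congr_right fun _ => ⟨fun H => ?_, fun H => ?_⟩
    · exact epsCheck_omega h m M (epsCheck_sub h k hk) ((epsCheck_iff h m M).1 H)
    · exact epsCheck_mono Set.inter_subset_right m H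

end CotPaper
end

section
/- Let X = add(X) be a cosuspended subcategory of a triangulated category T and ω an X-injective weak-cogenerator in X. Then ∩_{i∈ℤ} X[i] = {0} if and only if ω is a cogenerator in the triangulated category Δ̄_T(X), i.e., an object C of Δ̄_T(X) with Hom(C, W[i]) = 0 for all W ∈ ω and all i ∈ ℤ must be zero. -/
open CategoryTheory CategoryTheory.Limits CategoryTheory.Pretriangulated

universe v u

variable (C : Type u) [Category.{v} C] [HasZeroObject C] [HasShift C ℤ]
  [Preadditive C] [∀ n : ℤ, (CategoryTheory.shiftFunctor C n).Additive]
  [Pretriangulated C]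

namespace CotPaper

variable {C}

theorem aux_mem_shf {X : Set C} (h : isoClosed X) (Z : C) (n : ℤ) :
    Z ∈ shf X n ↔ Z⟦-n⟧ ∈ X := by
  constructor
  · rintro ⟨A, hA, ⟨e⟩⟩
    exact h hA ((shiftFunctorCompIsoId C n (-n) (by simp)).symm.app A ≪≫
      (shiftFunctor C (-n)).mapIso e.symm)
  · intro hZ
    exact ⟨_, hZ, ⟨(shiftFunctorCompIsoId C (-n) n (by simp)).symm.app Z⟩⟩

theorem aux_shift_add {X : Set C} (h : isoClosed X) {Z : C} {a b c : ℤ} (habc : a + b = c) :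
    Z⟦a⟧⟦b⟧ ∈ X ↔ Z⟦c⟧ ∈ X := by
  have e : Z⟦c⟧ ≅ Z⟦a⟧⟦b⟧ := (shiftFunctorAdd' C a b c habc).app Z
  exact ⟨fun hh => h hh e.symm, fun hh => h hh e⟩

theorem aux_neg {X : Set C} (h : isoClosed X) (hX : cosuspended X) {Z : C} {a : ℤ} (n : ℕ)
    (hZ : Z⟦a⟧ ∈ X) : Z⟦a - n⟧ ∈ X := by
  induction n with
  | zero => simpa using hZ
  | succ k ih =>
    have : Z⟦a - k⟧⟦(-1 : ℤ)⟧ ∈ X := hX.1 ⟨_, ih, ⟨Iso.refl _⟩⟩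
    exact (aux_shift_add h (by push_cast; ring)).1 this

theorem aux_le {X : Set C} (h : isoClosed X) (hX : cosuspended X) {Z : C} {a b : ℤ}
    (hab : b ≤ a) (hZ : Z⟦a⟧ ∈ X) : Z⟦b⟧ ∈ X := by
  obtain ⟨n, hn⟩ := Int.eq_ofNat_of_zero_le (sub_nonneg.2 hab)
  have := aux_neg h hX n hZ
  rwa [← hn, sub_sub_cancel] at this

theorem aux_thick {X : Set C} (hX : cosuspended X) (hadd : isAdd X) :
    IsThick {Z : C | ∃ n : ℤ, Z⟦n⟧ ∈ X} := by
  obtain ⟨h, ⟨⟨O, hO, hO0⟩, _⟩, hs⟩ := hadd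
  refine ⟨⟨O, ⟨0, h hO ((shiftFunctorZero C ℤ).symm.app O)⟩, hO0⟩, ?_, ?_, ?_, ?_⟩
  · rintro A B ⟨n, hn⟩ e
    exact ⟨n, h hn ((shiftFunctor C n).mapIso e)⟩
  · rintro m Z ⟨A, ⟨n, hn⟩, ⟨e⟩⟩
    refine ⟨n - m, h ((aux_shift_add h (Z := A) (a := m) (b := n - m) (c := n) (by ring)).2 hn)
      ((shiftFunctor C (n - m)).mapIso e.symm)⟩
  · rintro Z ⟨A, B, f, g, k, ⟨n, hn⟩, ⟨m, hm⟩, hT⟩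
    refine ⟨min n m, hX.2 ?_⟩
    exact ⟨_, _, _, _, _, aux_le h hX (min_le_left _ _) hn, aux_le h hX (min_le_right _ _) hm,
      Triangle.shift_distinguished _ hT (min n m)⟩
  · rintro W Z ⟨n, hn⟩ ⟨i, r, hir⟩
    exact ⟨n, hs hn ⟨i⟦n⟧', r⟦n⟧', by rw [← Functor.map_comp, hir, CategoryTheory.Functor.map_id]⟩⟩

theorem aux_orth_s16 {A W : C} (n i j : ℤ) (hij : j + n = i) (h : ∀ f : A ⟶ W⟦j⟧, f = 0)
    (f : A⟦n⟧ ⟶ W⟦i⟧) : f = 0 := by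
  let e := (shiftFunctorAdd' C j n i hij).app W
  obtain ⟨g, hg⟩ := (shiftFunctor C n).map_surjective (f ≫ e.hom)
  rw [h g, Functor.map_zero] at hg
  rw [← cancel_mono e.hom, ← hg, zero_comp]

theorem aux_step {X ω : Set C} (hadd : isAdd X)
    (hcog : weakCogenerator ω X) {A : C} (hA : A ∈ X)
    (ho : ∀ W ∈ ω, ∀ f : A ⟶ W, f = 0) : A⟦(1 : ℤ)⟧ ∈ X := by
  obtain ⟨h, _, hs⟩ := hadd
  obtain ⟨K, W, f, g, k, hK, hW, hT⟩ := hcog.2 hA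
  have hK' : K⟦(1 : ℤ)⟧ ∈ X := by simpa using (aux_mem_shf h K (-1)).1 hK
  have key : ∃ s : A ⟶ K, 𝟙 A = s ≫ f :=
    Triangle.coyoneda_exact₂ _ hT (𝟙 A) (by
      have hg := ho W hW g
      subst hg
      exact comp_zero)
  obtain ⟨s, hs1⟩ := key
  exact hs hK' ⟨s⟦(1 : ℤ)⟧', f⟦(1 : ℤ)⟧', by
    rw [← Functor.map_comp, ← hs1, CategoryTheory.Functor.map_id]⟩

theorem aux_all {X ω : Set C} (hadd : isAdd X)
    (hcog : weakCogenerator ω X) {A : C} {a : ℤ} (hA : A⟦a⟧ ∈ X)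
    (ho : ∀ i : ℤ, ∀ W ∈ ω, ∀ f : A ⟶ W⟦i⟧, f = 0) (n : ℕ) : A⟦a + n⟧ ∈ X := by
  induction n with
  | zero => simpa using hA
  | succ k ih =>
    refine (aux_shift_add hadd.1 (by push_cast; ring)).1 (aux_step hadd hcog ih ?_)
    intro W hW f
    rw [← cancel_mono ((shiftFunctorZero C ℤ).symm.app W).hom, zero_comp]
    exact aux_orth_s16 (a + k) 0 (-(a + k)) (by ring) (ho _ W hW) _

theorem aux_inj {X ω : Set C} (hinj : xInjective X ω) {W : C} (hW : W ∈ ω) {A : C} (hA : A ∈ X)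
    (i : ℤ) (hi : 0 < i) (f : A ⟶ W⟦i⟧) : f = 0 := by
  have h0 := hinj W hW
  unfold idDim at h0
  have hne : Set.Nonempty {n : ℕ∞ | ∃ m : ℕ, n = (m : ℕ∞) ∧
      ∀ i : ℤ, (m : ℤ) < i → ∀ A ∈ X, ∀ f : A ⟶ W⟦i⟧, f = 0} := by
    by_contra hh
    rw [Set.not_nonempty_iff_eq_empty] at hh
    rw [hh, sInf_empty] at h0
    exact absurd h0 (by simp)
  have := csInf_mem hne
  rw [h0] at this
  obtain ⟨m, hm, H⟩ := this
  have : m = 0 := by exact_mod_cast hm.symm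
  subst this
  exact H i (by simpa using hi) A hA f

/-- Let `X = add X` be a cosuspended subcategory of `T` and `ω` an
`X`-injective weak-cogenerator in `X`. Then `∩_{i∈ℤ} X[i] = {0}` if and only if `ω` is a
cogenerator in `Δ̄_T(X)`, i.e. any object `Z` of `Δ̄_T(X)` with `Hom(Z, W[i]) = 0` for all
`W ∈ ω` and all `i ∈ ℤ` is zero. -/
theorem stmt16 (X ω : Set C) (hX : cosuspended X) (hadd : isAdd X)
    (hinj : xInjective X ω) (hcog : weakCogenerator ω X) :
    (⋂ i : ℤ, shf X i) = {Z : C | IsZero Z} ↔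
      ∀ Z ∈ thickClosure X,
        (∀ i : ℤ, ∀ W ∈ ω, ∀ f : Z ⟶ W⟦i⟧, f = 0) → IsZero Z := by
  have h := hadd.1
  constructor
  · intro hint Z hZ ho
    obtain ⟨n, hn⟩ := hZ _ ⟨aux_thick hX hadd, fun A hA =>
      ⟨0, h hA ((shiftFunctorZero C ℤ).symm.app A)⟩⟩
    have : Z ∈ ⋂ i : ℤ, shf X i := by
      rw [Set.mem_iInter]
      intro i
      rw [aux_mem_shf h]
      exact aux_le h hX (by have := Int.self_le_toNat (-i - n); linarith)
        (aux_all hadd hcog hn ho (-i - n).toNat)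
    rw [hint] at this
    exact this
  · intro H
    ext Z
    rw [Set.mem_iInter]
    constructor
    · intro hZ
      refine H Z ?_ ?_
      · intro S hS
        obtain ⟨A, hA, ⟨e⟩⟩ := hZ 0
        exact hS.2 (h hA (((shiftFunctorZero C ℤ).app A).symm ≪≫ e.symm))
      · intro i W hW f
        obtain ⟨A, hA, ⟨e⟩⟩ := hZ (i - 1)
        rw [← cancel_epi e.inv, comp_zero]
        exact aux_orth_s16 (i - 1) i 1 (by ring) (aux_inj hinj hW hA 1 one_pos) _
    · intro hZ i
      obtain ⟨O, hO, hO0⟩ := hadd.2.1.1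
      exact ⟨O, hO, ⟨hZ.iso ((shiftFunctor C i).map_isZero hO0)⟩⟩

end CotPaper
end

section
/- Let (X, Y) be a bounded below co-t-structure on a triangulated category T and ω := X ∩ Y. Then (X, Y) is non-degenerate below if and only if ω is a cogenerator in T. -/
open CategoryTheory CategoryTheory.Limits CategoryTheory.Pretriangulated

universe v u

variable (C : Type u) [Category.{v} C] [HasZeroObject C] [HasShift C ℤ]
  [Preadditive C] [∀ n : ℤ, (CategoryTheory.shiftFunctor C n).Additive]
  [Pretriangulated C]

namespace CotPaper

variable {C}

/-- All morphisms `Z ⟶ W` vanish. -/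
def NoHom (Z W : C) : Prop := ∀ f : Z ⟶ W, f = 0

lemma NoHom.iso {Z Z' W W' : C} (hN : NoHom Z W) (e : Z' ≅ Z) (e' : W' ≅ W) : NoHom Z' W' := by
  intro f
  have h1 := hN (e.inv ≫ f ≫ e'.hom)
  have h2 : f = e.hom ≫ (e.inv ≫ f ≫ e'.hom) ≫ e'.inv := by simp
  rw [h2, h1]; simp

lemma NoHom.shift {Z W : C} (hN : NoHom Z W) (n : ℤ) : NoHom (Z⟦n⟧) (W⟦n⟧) := by
  intro f
  obtain ⟨g, rfl⟩ := (shiftFunctor C n).map_surjective f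
  rw [hN g]; simp

lemma noHom_shift {Z W : C} {b c : ℤ} (a : ℤ) (hbc : a + c = b) :
    NoHom (Z⟦a⟧) (W⟦b⟧) ↔ NoHom Z (W⟦c⟧) := by
  constructor
  · intro hN
    exact (hN.shift (-a)).iso (shiftShiftNeg Z a).symm
      ((shiftFunctorAdd' C b (-a) c (by omega)).app W)
  · intro hN
    exact (hN.shift a).iso (Iso.refl _) ((shiftFunctorAdd' C c a b (by omega)).app W)

lemma noHom_shift_left {Z W : C} (a : ℤ) :
    NoHom (Z⟦a⟧) W ↔ NoHom Z (W⟦-a⟧) := by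
  rw [← noHom_shift a (b := 0) (by omega)]
  exact ⟨fun hN => hN.iso (Iso.refl _) ((shiftFunctorZero C ℤ).app W),
    fun hN => hN.iso (Iso.refl _) ((shiftFunctorZero C ℤ).app W).symm⟩

section exactness

variable {P Q R D : C} {f : P ⟶ Q} {g : Q ⟶ R} {w : R ⟶ P⟦(1 : ℤ)⟧}

lemma co2 (hT : Triangle.mk f g w ∈ distTriang C) (u : D ⟶ Q) (hu : u ≫ g = 0) :
    ∃ v : D ⟶ P, u = v ≫ f := Triangle.coyoneda_exact₂ _ hT u hu

lemma yo2 (hT : Triangle.mk f g w ∈ distTriang C) (u : Q ⟶ D) (hu : f ≫ u = 0) :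
    ∃ v : R ⟶ D, u = g ≫ v := Triangle.yoneda_exact₂ _ hT u hu

lemma yo3 (hT : Triangle.mk f g w ∈ distTriang C) (u : R ⟶ D) (hu : g ≫ u = 0) :
    ∃ v : P⟦(1 : ℤ)⟧ ⟶ D, u = w ≫ v := Triangle.yoneda_exact₃ _ hT u hu

end exactness

lemma exists_decomp {X Y : Set C} (h : IsCotStructure Set.univ X Y) (Z : C) :
    Z ∈ star (shf X (-1)) Y := by
  rw [← h.decomp]; trivial

lemma mem_shf_iff {X Y : Set C} (h : IsCotStructure Set.univ X Y) (k : ℤ) (Z : C) :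
    Z ∈ shf X k ↔ ∀ B ∈ Y, NoHom Z (B⟦k + 1⟧) := by
  constructor
  · rintro ⟨A, hA, ⟨e⟩⟩ B hB
    have h1 : NoHom (A⟦(-1 : ℤ)⟧) B := h.orth _ ⟨A, hA, ⟨Iso.refl _⟩⟩ B hB
    rw [noHom_shift_left] at h1
    exact ((noHom_shift k (by omega)).2 h1).iso e (Iso.refl _)
  · intro hZ
    obtain ⟨A', B, f, g, w, ⟨A, hA, ⟨e⟩⟩, hB, hT⟩ := exists_decomp h (Z⟦-(k + 1)⟧)
    have hg : g = 0 := by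
      refine (noHom_shift_left _).2 ?_ g
      rw [neg_neg]; exact hZ B hB
    obtain ⟨s, hs⟩ := co2 hT (𝟙 _) (by simp [hg])
    have hs' : s ≫ f = 𝟙 _ := hs.symm
    -- `Z⟦-k⟧` is a summand of `A`
    let e1 : Z⟦-k⟧ ≅ (Z⟦-(k + 1)⟧)⟦(1 : ℤ)⟧ := (shiftFunctorAdd' C (-(k+1)) 1 (-k) (by omega)).app Z
    let e2 : A'⟦(1 : ℤ)⟧ ≅ A := (shiftFunctor C (1 : ℤ)).mapIso e ≪≫ shiftNegShift A (1 : ℤ)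
    refine ⟨Z⟦-k⟧, h.summandA hA ⟨e1.hom ≫ s⟦(1 : ℤ)⟧' ≫ e2.hom,
      e2.inv ≫ f⟦(1 : ℤ)⟧' ≫ e1.inv, ?_⟩, ⟨(shiftNegShift Z k).symm⟩⟩
    have : s⟦(1 : ℤ)⟧' ≫ f⟦(1 : ℤ)⟧' = 𝟙 _ := by rw [← Functor.map_comp, hs', CategoryTheory.Functor.map_id]
    simp [reassoc_of% this]

lemma mem_iff {X Y : Set C} (h : IsCotStructure Set.univ X Y) (Z : C) :
    Z ∈ X ↔ ∀ B ∈ Y, NoHom Z (B⟦(1 : ℤ)⟧) := by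
  have := mem_shf_iff h 0 Z
  rw [zero_add] at this
  rw [← this]
  exact ⟨fun hZ => ⟨Z, hZ, ⟨((shiftFunctorZero C ℤ).app Z).symm⟩⟩,
    fun ⟨A, hA, ⟨e⟩⟩ => h.isoA hA (e ≪≫ (shiftFunctorZero C ℤ).app A).symm⟩

lemma shf_succ {X Y : Set C} (h : IsCotStructure Set.univ X Y) (k : ℤ) {Z : C}
    (hZ : Z ∈ shf X k) : Z ∈ shf X (k + 1) := by
  rw [mem_shf_iff h] at hZ ⊢
  intro B hB
  exact (hZ (B⟦(1 : ℤ)⟧) (h.shiftB ⟨B, hB, ⟨Iso.refl _⟩⟩)).iso (Iso.refl _)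
    ((shiftFunctorAdd' C 1 (k+1) (k+1+1) (by omega)).app B)

lemma shf_mono {X Y : Set C} (h : IsCotStructure Set.univ X Y) {k l : ℤ} (hkl : k ≤ l) {Z : C}
    (hZ : Z ∈ shf X k) : Z ∈ shf X l :=
  Int.leInduction (m := k) (motive := fun l _ => Z ∈ shf X l) hZ
    (fun n _ hn => shf_succ h n hn) l hkl

lemma shf_pred {X Y : Set C} (h : IsCotStructure Set.univ X Y) (k : ℤ) {Z : C}
    (hZ : Z ∈ shf X k) (hω : ∀ W ∈ X ∩ Y, NoHom Z (W⟦k⟧)) : Z ∈ shf X (k - 1) := by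
  rw [mem_shf_iff h] at hZ ⊢
  obtain ⟨A', B, f, g, w, hA, hB, hT⟩ := exists_decomp h (Z⟦-k⟧)
  have hA' := hA
  rw [mem_shf_iff h] at hA'
  have hBX : B ∈ X := by
    rw [mem_iff h]
    intro D hD u
    have h1 : g ≫ u = 0 := (noHom_shift (-k) (by omega)).2 (hZ D hD) _
    obtain ⟨v, hv⟩ := yo3 hT u h1
    have h2 : v = 0 := NoHom.shift (h.orth _ hA D hD : NoHom A' D) 1 v
    rw [hv, h2]; simp
  have hg : g = 0 := by
    refine (noHom_shift_left _).2 ?_ g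
    rw [neg_neg]; exact hω B ⟨hBX, hB⟩
  intro D hD
  have : NoHom (Z⟦-k⟧) D := by
    intro u
    obtain ⟨v, hv⟩ := yo2 hT u (h.orth _ hA D hD _)
    rw [hv, hg, zero_comp]
  rw [noHom_shift_left, neg_neg] at this
  rwa [sub_add_cancel]

/-- Let `(X, Y)` be a bounded below co-t-structure on `T` and
`ω := X ∩ Y`. Then `(X, Y)` is non-degenerate below if and only if `ω` is a cogenerator
in `T`. -/
theorem stmt17 (X Y : Set C) (h : IsCotStructure Set.univ X Y)
    (hbb : (⋃ n : ℤ, shf X n) = Set.univ) :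
    (⋂ i : ℤ, shf X i) = {Z : C | IsZero Z} ↔
      ∀ Z : C, (∀ i : ℤ, ∀ W ∈ X ∩ Y, ∀ f : Z ⟶ W⟦i⟧, f = 0) → IsZero Z := by
  constructor
  · intro hnd Z hZ
    have hU : Z ∈ ⋃ n : ℤ, shf X n := by rw [hbb]; trivial
    obtain ⟨n, hn⟩ := Set.mem_iUnion.1 hU
    have hdown : ∀ m : ℕ, Z ∈ shf X (n - m) := by
      intro m
      induction m with
      | zero => simpa using hn
      | succ m ih =>
        have := shf_pred h (n - m) ih (fun W hW => hZ _ W hW)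
        have e : n - ((m + 1 : ℕ) : ℤ) = n - m - 1 := by push_cast; ring
        rwa [e]
    have : Z ∈ ⋂ i : ℤ, shf X i := by
      refine Set.mem_iInter.2 fun i => ?_
      exact shf_mono h (by omega) (hdown (n - i).toNat)
    rw [hnd] at this
    exact this
  · intro hc
    ext Z
    constructor
    · intro hZ
      refine hc Z fun i W hW => ?_
      have := (mem_shf_iff h (i - 1) Z).1 (Set.mem_iInter.1 hZ _) W hW.2
      rwa [sub_add_cancel] at this
    · intro hZ
      refine Set.mem_iInter.2 fun i => ?_
      rw [mem_shf_iff h]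
      intro B _ f
      exact (hZ : IsZero Z).eq_of_src _ _

end CotPaper
end

section
/- Let ω be a silting class in a triangulated category T with add(ω) = ω, and let _ωŪ be the smallest cosuspended subcategory of T closed under direct summands and containing ω. Then ω is an _ωŪ-injective weak-cogenerator in _ωŪ, i.e., id_{_ωŪ}(ω) = 0 and ω ⊆ _ωŪ ⊆ _ωŪ[-1]*ω. -/
open CategoryTheory CategoryTheory.Limits CategoryTheory.Pretriangulated

universe v u

variable (C : Type u) [Category.{v} C] [HasZeroObject C] [HasShift C ℤ]
  [Preadditive C] [∀ n : ℤ, (CategoryTheory.shiftFunctor C n).Additive]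
  [Pretriangulated C]

namespace CotPaper

variable {C}

lemma U_ind (ω S : Set C) (h0 : ω ⊆ S) (h1 : shf S (-1) ⊆ S) (h2 : star S S ⊆ S)
    (h3 : summandClosed S) : uMinusBar ω ⊆ S := fun _ hZ => hZ S ⟨⟨h1, h2⟩, h3, h0⟩

lemma U_sub (ω : Set C) : ω ⊆ uMinusBar ω := fun _ hW _ hS => hS.2.2 hW

lemma U_summand (ω : Set C) : summandClosed (uMinusBar ω) :=
  fun _ _ hW h S hS => hS.2.1 (hW S hS) h

lemma U_iso (ω : Set C) {A B : C} (hA : A ∈ uMinusBar ω) (e : A ≅ B) : B ∈ uMinusBar ω :=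
  U_summand ω hA ⟨e.inv, e.hom, e.inv_hom_id⟩

lemma U_shift (ω : Set C) : shf (uMinusBar ω) (-1) ⊆ uMinusBar ω := by
  rintro Z ⟨A, hA, e⟩ S hS
  exact hS.1.1 ⟨A, hA S hS, e⟩

lemma U_ext (ω : Set C) : star (uMinusBar ω) (uMinusBar ω) ⊆ uMinusBar ω := by
  rintro Z ⟨A, B, f, g, h, hA, hB, hT⟩ S hS
  exact hS.1.2 ⟨A, B, f, g, h, hA S hS, hB S hS, hT⟩

lemma U_shift' (ω : Set C) {A : C} (hA : A ∈ uMinusBar ω) : A⟦(-1 : ℤ)⟧ ∈ uMinusBar ω :=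
  U_shift ω ⟨A, hA, ⟨Iso.refl _⟩⟩

section exactness

variable {X Y Z : C} {f : X ⟶ Y} {g : Y ⟶ Z} {h : Z ⟶ X⟦(1 : ℤ)⟧}

lemma cex2 (hT : Triangle.mk f g h ∈ distTriang C) {P : C} (y : P ⟶ Y) (hy : y ≫ g = 0) :
    ∃ x : P ⟶ X, y = x ≫ f := Triangle.coyoneda_exact₂ _ hT y hy

lemma cex3 (hT : Triangle.mk f g h ∈ distTriang C) {P : C} (y : P ⟶ Z) (hy : y ≫ h = 0) :
    ∃ x : P ⟶ Y, y = x ≫ g := Triangle.coyoneda_exact₃ _ hT y hy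

lemma cex1 (hT : Triangle.mk f g h ∈ distTriang C) {P : C} (y : P ⟶ X⟦(1 : ℤ)⟧)
    (hy : y ≫ f⟦(1 : ℤ)⟧' = 0) :
    ∃ x : P ⟶ Z, y = x ≫ h := Triangle.coyoneda_exact₁ _ hT y hy

lemma rot1 (hT : Triangle.mk f g h ∈ distTriang C) :
    Triangle.mk g h (-f⟦(1 : ℤ)⟧') ∈ distTriang C := rot_of_distTriang _ hT

lemma cex2' (hT : Triangle.mk f g h ∈ distTriang C) {P : C} (y : P ⟶ Y⟦(1 : ℤ)⟧)
    (hy : y ≫ g⟦(1 : ℤ)⟧' = 0) :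
    ∃ x : P ⟶ X⟦(1 : ℤ)⟧, y = x ≫ f⟦(1 : ℤ)⟧' := by
  obtain ⟨x, hx⟩ := cex1 (rot1 hT) y hy
  exact ⟨-x, by rw [hx, Preadditive.comp_neg, Preadditive.neg_comp]⟩

lemma yex2 (hT : Triangle.mk f g h ∈ distTriang C) {P : C} (y : Y ⟶ P) (hy : f ≫ y = 0) :
    ∃ x : Z ⟶ P, y = g ≫ x := Triangle.yoneda_exact₂ _ hT y hy

lemma yex3 (hT : Triangle.mk f g h ∈ distTriang C) {P : C} (y : Z ⟶ P) (hy : g ≫ y = 0) :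
    ∃ x : X⟦(1 : ℤ)⟧ ⟶ P, y = h ≫ x := Triangle.yoneda_exact₃ _ hT y hy

lemma yex1' (hT : Triangle.mk f g h ∈ distTriang C) {P : C} (y : X⟦(1 : ℤ)⟧ ⟶ P)
    (hy : h ≫ y = 0) : ∃ x : Y⟦(1 : ℤ)⟧ ⟶ P, y = f⟦(1 : ℤ)⟧' ≫ x := by
  obtain ⟨x, hx⟩ := yex3 (rot1 hT) y hy
  exact ⟨-x, by rw [hx, Preadditive.comp_neg, Preadditive.neg_comp]⟩

lemma yex2' (hT : Triangle.mk f g h ∈ distTriang C) {P : C} (y : Y⟦(1 : ℤ)⟧ ⟶ P)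
    (hy : f⟦(1 : ℤ)⟧' ≫ y = 0) : ∃ x : Z⟦(1 : ℤ)⟧ ⟶ P, y = g⟦(1 : ℤ)⟧' ≫ x :=
  yex1' (rot1 hT) y (by rw [Preadditive.neg_comp, hy, neg_zero])

end exactness

/-- isomorphism `A⟦-1⟧⟦1⟧ ≅ A`. -/
noncomputable def sIso (A : C) : A⟦(-1 : ℤ)⟧⟦(1 : ℤ)⟧ ≅ A :=
  (shiftFunctorCompIsoId C (-1 : ℤ) 1 (by norm_num)).app A

/-- `E ⟶ X` whose cone lies in the right orthogonal of `U`. -/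
def good (U : Set C) {E X : C} (g : E ⟶ X) : Prop :=
  (∀ P ∈ U, ∀ x : P ⟶ X, ∃ y : P ⟶ E, y ≫ g = x) ∧
  (∀ P ∈ U, ∀ e : P ⟶ E⟦(1 : ℤ)⟧, e ≫ g⟦(1 : ℤ)⟧' = 0 → e = 0)

lemma good.lift1 {ω : Set C} {E X : C} {g : E ⟶ X} (hg : good (uMinusBar ω) g) {P : C}
    (hP : P ∈ uMinusBar ω) (x : P ⟶ X⟦(1 : ℤ)⟧) :
    ∃ y : P ⟶ E⟦(1 : ℤ)⟧, y ≫ g⟦(1 : ℤ)⟧' = x := by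
  obtain ⟨x', hx'⟩ := (shiftFunctor C (1 : ℤ)).map_surjective ((sIso P).hom ≫ x)
  obtain ⟨y, hy⟩ := hg.1 _ (U_shift' ω hP) x'
  refine ⟨(sIso P).inv ≫ y⟦(1 : ℤ)⟧', ?_⟩
  rw [Category.assoc, ← Functor.map_comp, hy, hx', Iso.inv_hom_id_assoc]

lemma good_id (U : Set C) (X : C) : good U (𝟙 X) :=
  ⟨fun _ _ x => ⟨x, by simp⟩, fun _ _ e he => by simpa using he⟩

lemma good_of_cone {U : Set C} {E X Y : C} {g : E ⟶ X} {k : X ⟶ Y} {h : Y ⟶ E⟦(1 : ℤ)⟧}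
    (hT : Triangle.mk g k h ∈ distTriang C) (hY : ∀ P ∈ U, ∀ y : P ⟶ Y, y = 0) : good U g := by
  refine ⟨fun P hP x => ?_, fun P hP e he => ?_⟩
  · obtain ⟨y, hy⟩ := cex2 hT x (hY P hP _)
    exact ⟨y, hy.symm⟩
  · obtain ⟨y, hy⟩ := cex1 hT e he
    rw [hy, hY P hP y, zero_comp]

lemma good.cone {U : Set C} {E X Y : C} {g : E ⟶ X} {k : X ⟶ Y} {h : Y ⟶ E⟦(1 : ℤ)⟧}
    (hg : good U g) (hT : Triangle.mk g k h ∈ distTriang C) : ∀ P ∈ U, ∀ y : P ⟶ Y, y = 0 := by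
  intro P hP y
  have h31 : h ≫ g⟦(1 : ℤ)⟧' = 0 := comp_distTriang_mor_zero₃₁ _ hT
  have h12 : g ≫ k = 0 := comp_distTriang_mor_zero₁₂ _ hT
  have h0 : y ≫ h = 0 := hg.2 P hP _ (by rw [Category.assoc, h31, comp_zero])
  obtain ⟨x, hx⟩ := cex3 hT y h0
  obtain ⟨z, hz⟩ := hg.1 P hP x
  rw [hx, ← hz]
  rw [Category.assoc, h12, comp_zero]

lemma good_mid {U : Set C} {E₁ E₂ E₃ X₁ X₂ X₃ : C}
    {a : E₁ ⟶ E₂} {b : E₂ ⟶ E₃} {c : E₃ ⟶ E₁⟦(1 : ℤ)⟧}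
    {a' : X₁ ⟶ X₂} {b' : X₂ ⟶ X₃} {c' : X₃ ⟶ X₁⟦(1 : ℤ)⟧}
    (hT : Triangle.mk a b c ∈ distTriang C) (hT' : Triangle.mk a' b' c' ∈ distTriang C)
    {g₁ : E₁ ⟶ X₁} {g₂ : E₂ ⟶ X₂} {g₃ : E₃ ⟶ X₃}
    (ha : a ≫ g₂ = g₁ ≫ a') (hb : b ≫ g₃ = g₂ ≫ b') (hc : c ≫ g₁⟦(1 : ℤ)⟧' = g₃ ≫ c')
    (h₁ : good U g₁) (h₃ : good U g₃) : good U g₂ := by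
  have z23 : b' ≫ c' = 0 := comp_distTriang_mor_zero₂₃ _ hT'
  have z31 : c ≫ a⟦(1 : ℤ)⟧' = 0 := comp_distTriang_mor_zero₃₁ _ hT
  refine ⟨fun P hP x => ?_, fun P hP e he => ?_⟩
  · obtain ⟨e3, he3⟩ := h₃.1 P hP (x ≫ b')
    have h0 : e3 ≫ c = 0 := h₁.2 P hP _ (by
      rw [Category.assoc, hc, ← Category.assoc, he3, Category.assoc, z23, comp_zero])
    obtain ⟨e2, he2⟩ := cex3 hT e3 h0
    obtain ⟨x1, hx1⟩ := cex2 hT' (x - e2 ≫ g₂) (by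
      rw [Preadditive.sub_comp, Category.assoc, ← hb, ← Category.assoc, ← he2, he3, sub_self])
    obtain ⟨e1, he1⟩ := h₁.1 P hP x1
    refine ⟨e1 ≫ a + e2, ?_⟩
    rw [Preadditive.add_comp, Category.assoc, ha, ← Category.assoc, he1, ← hx1, sub_add_cancel]
  · have h0 : e ≫ b⟦(1 : ℤ)⟧' = 0 := h₃.2 P hP _ (by
      rw [Category.assoc, ← Functor.map_comp, hb, Functor.map_comp, ← Category.assoc, he,
        zero_comp])
    obtain ⟨e1, he1⟩ := cex2' hT e h0
    obtain ⟨x, hx⟩ := cex1 hT' (e1 ≫ g₁⟦(1 : ℤ)⟧') (by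
      rw [Category.assoc, ← Functor.map_comp, ← ha, Functor.map_comp, ← Category.assoc, ← he1, he])
    obtain ⟨y, hy⟩ := h₃.1 P hP x
    have h2 : e1 - y ≫ c = 0 := h₁.2 P hP _ (by
      rw [Preadditive.sub_comp, hx, Category.assoc, hc, ← Category.assoc, hy, sub_self])
    rw [he1, sub_eq_zero.1 h2, Category.assoc, z31, comp_zero]

/-- `X` admits a good map from an object of `U`. -/
def resol (U : Set C) (X : C) : Prop := ∃ (E : C) (g : E ⟶ X), E ∈ U ∧ good U g

lemma resol_self {U : Set C} {X : C} (h : X ∈ U) : resol U X := ⟨X, 𝟙 X, h, good_id U X⟩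

lemma resol_ext {ω : Set C} {X₁ X₂ X₃ : C} {a' : X₁ ⟶ X₂} {b' : X₂ ⟶ X₃} {c' : X₃ ⟶ X₁⟦(1 : ℤ)⟧}
    (hT' : Triangle.mk a' b' c' ∈ distTriang C) (h₁ : resol (uMinusBar ω) X₁)
    (h₃ : resol (uMinusBar ω) X₃) : resol (uMinusBar ω) X₂ := by
  obtain ⟨E₁, g₁, hE₁, hg₁⟩ := h₁
  obtain ⟨E₃, g₃, hE₃, hg₃⟩ := h₃
  obtain ⟨c, hc⟩ := hg₁.lift1 hE₃ (g₃ ≫ c')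
  obtain ⟨E₂, a, b, hT⟩ := distinguished_cocone_triangle₂ c
  obtain ⟨g₂, ha, hb⟩ := complete_distinguished_triangle_morphism₂ _ _ hT hT' g₁ g₃ hc
  exact ⟨E₂, g₂, U_ext ω ⟨_, _, _, _, _, hE₁, hE₃, hT⟩, good_mid hT hT' ha hb hc hg₁ hg₃⟩

lemma mem_of_resol {ω : Set C} {X : C} (h : resol (uMinusBar ω) X)
    (hX : X ∈ leftOrth (rightOrth (uMinusBar ω))) : X ∈ uMinusBar ω := by
  obtain ⟨E, g, hE, hg⟩ := h
  obtain ⟨Y, k, l, hT⟩ := distinguished_cocone_triangle g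
  have hk : k = 0 := hX Y (hg.cone hT) k
  obtain ⟨i, hi⟩ := cex2 hT (𝟙 X) (by rw [hk, comp_zero])
  exact U_summand ω hE ⟨i, g, hi.symm⟩

/-- Preenvelopes. -/
def preenv (U : Set C) {Z W : C} (f : Z ⟶ W) : Prop :=
  ∀ Y ∈ rightOrth U, ∀ l : Z⟦(1 : ℤ)⟧ ⟶ Y, ∃ m : W⟦(1 : ℤ)⟧ ⟶ Y, l = f⟦(1 : ℤ)⟧' ≫ m

lemma cone_mem {ω : Set C} {Z W K : C} {f : Z ⟶ W} {g : W ⟶ K} {h : K ⟶ Z⟦(1 : ℤ)⟧}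
    (hT : Triangle.mk f g h ∈ distTriang C) (hW : W ∈ ω) (hf : preenv (uMinusBar ω) f)
    (hZ : resol (uMinusBar ω) (Z⟦(1 : ℤ)⟧)) : K ∈ uMinusBar ω := by
  refine mem_of_resol (resol_ext (rot1 hT) (resol_self (U_sub ω hW)) hZ) ?_
  intro Y hY k
  obtain ⟨l, hl⟩ := yex3 hT k (hY W (U_sub ω hW) _)
  obtain ⟨m, hm⟩ := hf Y hY l
  have h31 : h ≫ f⟦(1 : ℤ)⟧' = 0 := comp_distTriang_mor_zero₃₁ _ hT
  rw [hl, hm, ← Category.assoc, h31, zero_comp]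

lemma U_hom (ω : Set C) (hs : silting ω) {W : C} (hW : W ∈ ω) {A : C} (hA : A ∈ uMinusBar ω)
    (i : ℤ) (hi : 0 < i) (f : A ⟶ W⟦i⟧) : f = 0 := by
  have key : uMinusBar ω ⊆ {A : C | ∀ i : ℤ, 0 < i → ∀ f : A ⟶ W⟦i⟧, f = 0} := by
    apply U_ind
    · intro A hA i hi f
      exact hs A hA W hW i hi f
    · rintro Z ⟨A, hA, ⟨e⟩⟩ i hi f
      apply (shiftFunctor C (1 : ℤ)).map_injective
      have := hA (i + 1) (by omega) ((sIso A).inv ≫ (e.inv ≫ f)⟦(1 : ℤ)⟧' ≫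
        (shiftFunctorAdd C i 1).inv.app W)
      rw [Preadditive.IsIso.comp_left_eq_zero, Preadditive.IsIso.comp_right_eq_zero,
        Functor.map_comp, Preadditive.IsIso.comp_left_eq_zero] at this
      rw [this, Functor.map_zero]
    · rintro Z ⟨A, B, a, b, c, hA, hB, hT⟩ i hi f
      obtain ⟨x, hx⟩ := yex2 hT f (hA i hi _)
      rw [hx, hB i hi x, comp_zero]
    · rintro A Z hA ⟨j, r, hjr⟩ i hi f
      rw [← Category.id_comp f, ← hjr, Category.assoc, hA i hi (r ≫ f), comp_zero]
  exact key hA i hi f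

lemma isDirectSum_biprod (A B : C) : isDirectSum (A ⊞ B) A B :=
  ⟨biprod.inl, biprod.inr, biprod.fst, biprod.snd, by simp, by simp, by simp, by simp,
    biprod.total⟩

lemma exists_preenv (ω : Set C) (hs : silting ω) (hadd : isAdd ω) {Z : C}
    (hZ : Z ∈ uMinusBar ω) : ∃ (W : C) (f : Z ⟶ W), W ∈ ω ∧ preenv (uMinusBar ω) f := by
  have key : uMinusBar ω ⊆ {Z : C | Z ∈ uMinusBar ω ∧
      ∃ (W : C) (f : Z ⟶ W), W ∈ ω ∧ preenv (uMinusBar ω) f} := by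
    apply U_ind
    · intro W hW
      exact ⟨U_sub ω hW, W, 𝟙 W, hW, fun Y _ l => ⟨l, by simp⟩⟩
    · rintro Z ⟨A, ⟨hA, -⟩, ⟨e⟩⟩
      obtain ⟨W, hW, -⟩ := hadd.2.1.1
      refine ⟨U_shift ω ⟨A, hA, ⟨e⟩⟩, W, 0, hW, fun Y hY l => ⟨0, ?_⟩⟩
      rw [comp_zero]
      exact hY _ (U_iso ω hA ((sIso A).symm ≪≫ (shiftFunctor C (1 : ℤ)).mapIso e.symm)) l
    · rintro Z ⟨A, B, a, b, c, ⟨hA, WA, fA, hWA, hfA⟩, ⟨hB, WB, fB, hWB, hfB⟩, hT⟩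
      refine ⟨U_ext ω ⟨A, B, a, b, c, hA, hB, hT⟩, ?_⟩
      obtain ⟨q', hq'⟩ := yex1' hT (fA⟦(1 : ℤ)⟧') (U_hom ω hs hWA hB 1 (by norm_num) _)
      obtain ⟨q, rfl⟩ := (shiftFunctor C (1 : ℤ)).map_surjective q'
      refine ⟨WA ⊞ WB, biprod.lift q (b ≫ fB), hadd.2.1.2 hWA hWB (isDirectSum_biprod WA WB), ?_⟩
      intro Y hY l
      obtain ⟨lA, hlA⟩ := hfA Y hY (a⟦(1 : ℤ)⟧' ≫ l)
      obtain ⟨l2, hl2⟩ := yex2' hT (l - q⟦(1 : ℤ)⟧' ≫ lA) (by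
        rw [Preadditive.comp_sub, hlA, ← Category.assoc, ← hq', sub_self])
      obtain ⟨lB, hlB⟩ := hfB Y hY l2
      refine ⟨(biprod.fst : WA ⊞ WB ⟶ WA)⟦(1 : ℤ)⟧' ≫ lA +
        (biprod.snd : WA ⊞ WB ⟶ WB)⟦(1 : ℤ)⟧' ≫ lB, ?_⟩
      rw [Preadditive.comp_add, ← Category.assoc, ← Category.assoc, ← Functor.map_comp,
        ← Functor.map_comp, biprod.lift_fst, biprod.lift_snd, Functor.map_comp, Category.assoc,
        ← hlB, ← hl2]
      abel
    · rintro A Z ⟨hA, W, f, hW, hf⟩ ⟨i, r, hir⟩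
      refine ⟨U_summand ω hA ⟨i, r, hir⟩, W, i ≫ f, hW, fun Y hY l => ?_⟩
      obtain ⟨m, hm⟩ := hf Y hY (r⟦(1 : ℤ)⟧' ≫ l)
      refine ⟨m, ?_⟩
      rw [Functor.map_comp, Category.assoc, ← hm, ← Category.assoc, ← Functor.map_comp, hir,
        CategoryTheory.Functor.map_id, Category.id_comp]
  exact (key hZ).2

lemma resol_shift (ω : Set C) (hs : silting ω) (hadd : isAdd ω) {Z : C}
    (hZ : Z ∈ uMinusBar ω) : resol (uMinusBar ω) (Z⟦(1 : ℤ)⟧) := by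
  have key : uMinusBar ω ⊆ {Z : C | Z ∈ uMinusBar ω ∧ resol (uMinusBar ω) (Z⟦(1 : ℤ)⟧)} := by
    apply U_ind
    · intro W hW
      obtain ⟨O, hO, hO0⟩ := hadd.2.1.1
      refine ⟨U_sub ω hW, O, 0, U_sub ω hO, fun P hP x => ⟨0, ?_⟩, fun P hP e _ => ?_⟩
      · rw [zero_comp, U_hom ω hs hW hP 1 (by norm_num) x]
      · exact ((shiftFunctor C (1 : ℤ)).map_isZero hO0).eq_of_tgt _ _
    · rintro Z ⟨A, ⟨hA, -⟩, ⟨e⟩⟩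
      exact ⟨U_shift ω ⟨A, hA, ⟨e⟩⟩, resol_self
        (U_iso ω hA ((sIso A).symm ≪≫ (shiftFunctor C (1 : ℤ)).mapIso e.symm))⟩
    · rintro Z ⟨A, B, a, b, c, ⟨hA, hA'⟩, ⟨hB, hB'⟩, hT⟩
      exact ⟨U_ext ω ⟨A, B, a, b, c, hA, hB, hT⟩,
        resol_ext (rot1 (rot1 (rot1 hT))) hA' hB'⟩
    · rintro A Z ⟨hA, hA'⟩ ⟨i, r, hir⟩
      refine ⟨U_summand ω hA ⟨i, r, hir⟩, ?_⟩
      obtain ⟨W, f, hW, hf⟩ := exists_preenv ω hs hadd hA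
      let F : A ⟶ W ⊞ W := biprod.lift (r ≫ i ≫ f) (f - r ≫ i ≫ f)
      have hF : preenv (uMinusBar ω) F := by
        intro Y hY l
        obtain ⟨m, hm⟩ := hf Y hY l
        refine ⟨(biprod.fst + biprod.snd : W ⊞ W ⟶ W)⟦(1 : ℤ)⟧' ≫ m, ?_⟩
        have : F ≫ (biprod.fst + biprod.snd) = f := by
          rw [Preadditive.comp_add, biprod.lift_fst, biprod.lift_snd]; abel
        rw [← Category.assoc, ← Functor.map_comp, this, hm]
      obtain ⟨K', g', h', hT'⟩ := distinguished_cocone_triangle F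
      obtain ⟨K, g, h, hT⟩ := distinguished_cocone_triangle (i ≫ f)
      have hK' := cone_mem hT' (hadd.2.1.2 hW hW (isDirectSum_biprod W W)) hF hA'
      have e1 : (i ≫ f) ≫ biprod.inl = i ≫ F := by
        apply biprod.hom_ext
        · simp [F, reassoc_of% hir]
        · simp [F, reassoc_of% hir]
      have e2 : F ≫ biprod.fst = r ≫ i ≫ f := by simp [F]
      obtain ⟨u, hu1, hu2⟩ : ∃ u : K ⟶ K', g ≫ u = biprod.inl ≫ g' ∧ h ≫ i⟦(1 : ℤ)⟧' = u ≫ h' :=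
        complete_distinguished_triangle_morphism _ _ hT hT' i biprod.inl e1
      obtain ⟨v, hv1, hv2⟩ : ∃ v : K' ⟶ K, g' ≫ v = biprod.fst ≫ g ∧ h' ≫ r⟦(1 : ℤ)⟧' = v ≫ h :=
        complete_distinguished_triangle_morphism _ _ hT' hT r biprod.fst e2
      have hg : g ≫ (u ≫ v) = g := by
        rw [← Category.assoc, hu1, Category.assoc, hv1, biprod.inl_fst_assoc]
      have hh : (u ≫ v) ≫ h = h := by
        rw [Category.assoc, ← hv2, ← Category.assoc, ← hu2, Category.assoc, ← Functor.map_comp,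
          hir, CategoryTheory.Functor.map_id, Category.comp_id]
      let φ : Triangle.mk (i ≫ f) g h ⟶ Triangle.mk (i ≫ f) g h :=
        { hom₁ := 𝟙 Z
          hom₂ := 𝟙 W
          hom₃ := u ≫ v
          comm₁ := by
            change (i ≫ f) ≫ 𝟙 W = 𝟙 Z ≫ (i ≫ f)
            rw [Category.comp_id, Category.id_comp]
          comm₂ := by
            change g ≫ (u ≫ v) = 𝟙 W ≫ g
            rw [hg, Category.id_comp]
          comm₃ := by
            change h ≫ (𝟙 Z)⟦(1 : ℤ)⟧' = (u ≫ v) ≫ h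
            rw [hh, CategoryTheory.Functor.map_id, Category.comp_id] }
      have hiso : IsIso (u ≫ v) := isIso₃_of_isIso₁₂ φ hT hT
        (inferInstanceAs (IsIso (𝟙 Z))) (inferInstanceAs (IsIso (𝟙 W)))
      have hK : K ∈ uMinusBar ω :=
        U_summand ω hK' ⟨u, v ≫ inv (u ≫ v), by rw [← Category.assoc, IsIso.hom_inv_id]⟩
      exact ⟨K, h, hK, good_of_cone (rot1 (rot1 hT))
        (fun P hP y => U_hom ω hs hW hP 1 (by norm_num) y)⟩
  exact (key hZ).2

/-- Let `ω` be a silting class in `T` with `add ω = ω`, and let `_ωŪ` be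
the smallest cosuspended subcategory of `T` closed under direct summands containing `ω`.
Then `ω` is an `_ωŪ`-injective weak-cogenerator in `_ωŪ`. -/
theorem stmt18 (ω : Set C) (hs : silting ω) (hadd : isAdd ω) :
    xInjective (uMinusBar ω) ω ∧ ω ⊆ uMinusBar ω ∧
    uMinusBar ω ⊆ star (shf (uMinusBar ω) (-1)) ω := by
  refine ⟨fun W hW => ?_, U_sub ω, fun Z hZ => ?_⟩
  · refine le_antisymm (sInf_le ⟨0, by simp, ?_⟩) bot_le
    intro i hi A hA f
    exact U_hom ω hs hW hA i (by simpa using hi) f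
  · obtain ⟨W, f, hW, hf⟩ := exists_preenv ω hs hadd hZ
    obtain ⟨K, g, h, hT⟩ := distinguished_cocone_triangle f
    have hK := cone_mem hT hW hf (resol_shift ω hs hadd hZ)
    exact ⟨K⟦(-1 : ℤ)⟧, W, _, _, _, ⟨K, hK, ⟨Iso.refl _⟩⟩, hW, inv_rot_of_distTriang _ hT⟩

end CotPaper
end

section
/- Let (X, ω) be a pair of classes of objects in a triangulated category T with ω ⊆ X. Then: (a) if X is cosuspended and X = add(X), then the class X[-1]*ω is closed under direct summands; (b) if ω is silting and closed under finite direct sums, then ω is closed under extensions, i.e., ω*ω ⊆ ω. -/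
open CategoryTheory CategoryTheory.Limits CategoryTheory.Pretriangulated

universe v u

variable (C : Type u) [Category.{v} C] [HasZeroObject C] [HasShift C ℤ]
  [Preadditive C] [∀ n : ℤ, (CategoryTheory.shiftFunctor C n).Additive]
  [Pretriangulated C]

namespace CotPaper

variable {C}

lemma aux_exact {A W B : C} {f : A ⟶ W} {g : W ⟶ B} {h : B ⟶ A⟦(1:ℤ)⟧}
    (hT : Triangle.mk f g h ∈ distTriang C) :
    f ≫ g = 0 ∧ g ≫ h = 0 ∧ h ≫ f⟦(1:ℤ)⟧' = 0 ∧
    (∀ {T : C} (x : W ⟶ T), f ≫ x = 0 → ∃ y : B ⟶ T, x = g ≫ y) ∧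
    (∀ {T : C} (x : T ⟶ W), x ≫ g = 0 → ∃ y : T ⟶ A, x = y ≫ f) ∧
    (∀ {T : C} (x : T ⟶ B), x ≫ h = 0 → ∃ y : T ⟶ W, x = y ≫ g) ∧
    (∀ {T : C} (x : T ⟶ A⟦(1:ℤ)⟧), x ≫ f⟦(1:ℤ)⟧' = 0 → ∃ y : T ⟶ B, x = y ≫ h) :=
  ⟨comp_distTriang_mor_zero₁₂ _ hT, comp_distTriang_mor_zero₂₃ _ hT,
    comp_distTriang_mor_zero₃₁ _ hT,
    fun x hx => Triangle.yoneda_exact₂ _ hT x hx,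
    fun x hx => Triangle.coyoneda_exact₂ _ hT x hx,
    fun x hx => Triangle.coyoneda_exact₃ _ hT x hx,
    fun x hx => Triangle.coyoneda_exact₁ _ hT x hx⟩

lemma aux_split {A W B : C} {f : A ⟶ W} {g : W ⟶ B} {h : B ⟶ A⟦(1:ℤ)⟧}
    (hT : Triangle.mk f g h ∈ distTriang C) (h0 : h = 0) :
    isDirectSum W A B := by
  obtain ⟨hfg, -, -, -, e2, e3, -⟩ := aux_exact hT
  have hm : Mono f := Triangle.mono₁ _ hT h0
  obtain ⟨s, hs⟩ := e3 (𝟙 B) (by simp [h0])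
  obtain ⟨r, hr⟩ := e2 (𝟙 W - g ≫ s) (by simp [Preadditive.sub_comp, ← hs])
  refine ⟨f, s, r, g, ?_, hs.symm, hfg, ?_, ?_⟩
  · rw [← cancel_mono f, Category.assoc, ← hr]
    simp [Preadditive.comp_sub, reassoc_of% hfg]
  · rw [← cancel_mono f, Category.assoc, ← hr]
    simp [Preadditive.comp_sub, ← reassoc_of% hs]
  · rw [← hr]; abel

lemma aux_a_s19 (X ω : Set C) (hsub : ω ⊆ X) (hc : cosuspended X) (ha : isAdd X) :
    summandClosed (star (shf X (-1)) ω) := by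
  obtain ⟨hiso, ⟨-, hadd⟩, hsum⟩ := ha
  rintro W Z ⟨A, B, f, g, h, hA, hB, hT⟩ ⟨i, r, hir⟩
  have hWX : W ∈ X := hc.2 ⟨A, B, f, g, h, hc.1 hA, hsub hB, hT⟩
  have hA1 : A⟦(1:ℤ)⟧ ∈ X := by
    obtain ⟨A0, hA0, ⟨e⟩⟩ := hA
    exact hiso hA0 ((shiftFunctor C (1:ℤ)).mapIso e ≪≫
      (shiftFunctorCompIsoId C (-1:ℤ) 1 (by simp)).app A0).symm
  obtain ⟨hfg, hgh, hhf, -⟩ := aux_exact hT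
  -- the complement of `Z`
  obtain ⟨Z', p, d, hZ'⟩ := distinguished_cocone_triangle i
  obtain ⟨hip, hpd, hdi, z1, -, z3, -⟩ := aux_exact hZ'
  have hd : d = 0 := by
    have : d ≫ (i ≫ r)⟦(1:ℤ)⟧' = 0 := by
      rw [Functor.map_comp, reassoc_of% hdi, zero_comp]
    simpa [hir] using this
  obtain ⟨t, ht⟩ := z3 (𝟙 Z') (by simp [hd])
  have hZ'X : Z' ∈ X := hsum hWX ⟨t, p, ht.symm⟩
  obtain ⟨s, hs⟩ := z1 (𝟙 W - r ≫ i) (by simp [Preadditive.comp_sub, reassoc_of% hir])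
  -- the object `L`
  obtain ⟨L, j, q, hL⟩ := distinguished_cocone_triangle (f ≫ p)
  obtain ⟨-, -, hqf, -, -, -, l4⟩ := aux_exact hL
  have hLX : L ∈ X := hc.2 ⟨Z', A⟦(1:ℤ)⟧, j, q, _, hZ'X, hA1, rot_of_distTriang _ hL⟩
  -- the cone `K` of `Z ⟶ B`
  obtain ⟨K, k, δ, hK⟩ := distinguished_cocone_triangle (i ≫ g)
  obtain ⟨-, -, -, -, -, k3, k4⟩ := aux_exact hK
  obtain ⟨u, -, hu⟩ : ∃ u : K ⟶ A⟦(1:ℤ)⟧, k ≫ u = 𝟙 B ≫ h ∧ δ ≫ i⟦(1:ℤ)⟧' = u ≫ (-f⟦(1:ℤ)⟧') :=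
    complete_distinguished_triangle_morphism _ _ hK (rot_of_distTriang _ hT) i (𝟙 B)
      (Category.comp_id _)
  have hu' : u ≫ f⟦(1:ℤ)⟧' = - (δ ≫ i⟦(1:ℤ)⟧') := by rw [hu]; simp
  obtain ⟨v, hv⟩ := l4 u (by
    rw [Functor.map_comp, reassoc_of% hu', Preadditive.neg_comp, Category.assoc,
      ← Functor.map_comp, hip]
    simp)
  obtain ⟨v', hv'⟩ := k4 (-(q ≫ f⟦(1:ℤ)⟧' ≫ r⟦(1:ℤ)⟧')) (by
    have e : f ≫ r ≫ i ≫ g = - ((f ≫ p) ≫ s ≫ g) := by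
      have e1 : r ≫ i = 𝟙 W - p ≫ s := by rw [← hs]; abel
      rw [reassoc_of% e1]
      simp [Preadditive.sub_comp, Preadditive.comp_sub, hfg]
    rw [Preadditive.neg_comp, Category.assoc, Category.assoc, ← Functor.map_comp,
      ← Functor.map_comp, e, Functor.map_neg, Functor.map_comp, Preadditive.comp_neg,
      reassoc_of% hqf]
    simp)
  obtain ⟨w, hw⟩ := k3 (𝟙 K - v ≫ v') (by
    rw [Preadditive.sub_comp, Category.assoc, ← hv', Preadditive.comp_neg, ← reassoc_of% hv,
      reassoc_of% hu', Preadditive.neg_comp, Category.assoc, ← Functor.map_comp, hir]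
    simp)
  have hLB : (L ⊞ B) ∈ X := hadd hLX (hsub hB)
    ⟨biprod.inl, biprod.inr, biprod.fst, biprod.snd, by simp, by simp, by simp, by simp,
      biprod.total⟩
  have hKX : K ∈ X := hsum hLB ⟨biprod.lift v w, biprod.desc v' k, by
    rw [biprod.lift_desc, ← hw]; abel⟩
  exact ⟨K⟦(-1:ℤ)⟧, B, _, i ≫ g, _, ⟨K, hKX, ⟨Iso.refl _⟩⟩, hB, inv_rot_of_distTriang _ hK⟩

/-- Let `(X, ω)` be a pair of classes of objects with `ω ⊆ X`. Then:
(a) if `X` is cosuspended and `X = add X`, then `X[-1] * ω` is closed under direct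
summands; (b) if `ω` is silting and closed under finite direct sums, then `ω` is closed
under extensions, i.e. `ω * ω ⊆ ω`. -/
theorem stmt19 (X ω : Set C) (hsub : ω ⊆ X) :
    (cosuspended X → isAdd X → summandClosed (star (shf X (-1)) ω)) ∧
    (silting ω → (∀ ⦃A B W : C⦄, A ∈ ω → B ∈ ω → isDirectSum W A B → W ∈ ω) →
      star ω ω ⊆ ω) := by
  refine ⟨aux_a_s19 X ω hsub, ?_⟩
  rintro hs hd Z ⟨A, B, f, g, h, hA, hB, hT⟩
  exact hd hA hB (aux_split hT (hs B hB A hA 1 one_pos h))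


end CotPaper
end
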